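/- Let k be a positive rational number such that √k is irrational. Then there exist absolute positive constants C₁, C₂ and a positive constant C₃ = C₃(k) such that the following holds: for every N ∈ [1, ∞), δ ∈ (0, 1/2) and ξ ∈ [−1/2, 1/2), if | (1/N) ∑_{n=1}^{⌊N⌋} e(ξ n⌊n√k⌋) | > δ, then either N ≤ C₃ δ^{−2C₁}, or there exist q ∈ ℕ and a, b ∈ ℤ with q ≤ C₃ δ^{−C₁} and |b| ≤ C₃ δ^{−C₁} such that | ξ − (a + b√k)/q | < C₂ δ^{−C₁} N^{−1}. -/

import Mathlib

/-- `e(x) = exp(2πix)`. -/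
noncomputable def expc (x : ℝ) : ℂ := Complex.exp (2 * Real.pi * Complex.I * x)

/-- The exponential sum `(1/N) ∑_{n=1}^{⌊N⌋} e(ξ n⌊n√k⌋)`. -/
noncomputable def expSum (k N ξ : ℝ) : ℂ :=
  ((N : ℝ) : ℂ)⁻¹ * ∑ n ∈ Finset.Icc 1 (⌊N⌋).toNat,
      expc (ξ * ((n : ℝ) * (⌊(n : ℝ) * Real.sqrt k⌋ : ℝ)))

lemma expc_add (x y : ℝ) : expc (x + y) = expc x * expc y := by
  simp only [expc, ← Complex.exp_add]; congr 1; push_cast; ring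

lemma norm_expc (x : ℝ) : ‖expc x‖ = 1 := by
  have : expc x = Complex.exp ((2 * Real.pi * x : ℝ) * Complex.I) := by
    simp only [expc]; congr 1; push_cast; ring
  rw [this, Complex.norm_exp_ofReal_mul_I]

lemma expc_zero : expc 0 = 1 := by simp [expc]

lemma expc_int (m : ℤ) : expc m = 1 := by
  rw [expc, Complex.exp_eq_one_iff]
  exact ⟨m, by push_cast; ring⟩

lemma expc_add_int (x : ℝ) (m : ℤ) : expc (x + m) = expc x := by
  rw [expc_add, expc_int, mul_one]

lemma conj_expc (x : ℝ) : (starRingEnd ℂ) (expc x) = expc (-x) := by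
  rw [expc, expc, ← Complex.exp_conj]
  congr 1
  simp [Complex.conj_ofNat]

lemma expc_nat_mul (n : ℕ) (x : ℝ) : expc (n * x) = expc x ^ n := by
  rw [expc, expc, ← Complex.exp_nat_mul]; congr 1; push_cast; ring

lemma norm_expc_sub_one (x : ℝ) : ‖expc x - 1‖ = 2 * |Real.sin (Real.pi * x)| := by
  have h := Complex.norm_exp_I_mul_ofReal_sub_one (2 * Real.pi * x)
  have e : expc x = Complex.exp (Complex.I * ((2 * Real.pi * x : ℝ) : ℂ)) := by
    simp only [expc]; congr 1; push_cast; ring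
  rw [e, h, Real.norm_eq_abs, abs_mul, abs_two]
  congr 3; ring

lemma norm_expc_sub_expc_le (x y : ℝ) : ‖expc x - expc y‖ ≤ 2 * Real.pi * |x - y| := by
  have e : expc x - expc y = expc y * (expc (x - y) - 1) := by
    rw [mul_sub, ← expc_add, mul_one]; congr 2; ring
  rw [e, norm_mul, norm_expc, one_mul, norm_expc_sub_one]
  have h := Real.abs_sin_le_abs (x := Real.pi * (x - y))
  rw [abs_mul, abs_of_pos Real.pi_pos] at h
  linarith

/-- The chord `e(x) - 1` is at least four times the distance of `x` to the integers. -/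
lemma four_mul_abs_sub_round_le (x : ℝ) : 4 * |x - round x| ≤ ‖expc x - 1‖ := by
  have e : expc x = expc (x - round x) := by
    rw [← expc_add_int (x - round x) (round x)]; congr 1; ring
  rw [e, norm_expc_sub_one]
  have hr := abs_sub_round x
  set y := x - round x
  have h := Real.mul_le_sin (x := Real.pi * |y|) (by positivity)
    (by nlinarith [Real.pi_pos])
  have h2 : 2 / Real.pi * (Real.pi * |y|) = 2 * |y| := by field_simp
  have h3 : Real.sin (Real.pi * |y|) ≤ |Real.sin (Real.pi * y)| := by
    rcases abs_choice y with h | h <;> rw [h]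
    · exact le_abs_self _
    · rw [mul_neg, Real.sin_neg]; exact neg_le_abs _
  linarith

lemma expc_ne_one {x : ℝ} (h : ∀ m : ℤ, x ≠ m) : expc x ≠ 1 := by
  intro h1
  have := four_mul_abs_sub_round_le x
  rw [h1, sub_self, norm_zero] at this
  have h2 : |x - round x| = 0 := le_antisymm (by linarith) (abs_nonneg _)
  exact h (round x) (sub_eq_zero.mp (abs_eq_zero.mp h2))

lemma norm_geom_sum_mul_le (L : ℕ) (x : ℝ) :
    ‖∑ n ∈ Finset.range L, expc (n * x)‖ * |x - round x| ≤ 1 / 2 := by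
  have h1 : (∑ n ∈ Finset.range L, expc (n * x)) * (expc x - 1) = expc (L * x) - 1 := by
    simp only [expc_nat_mul]; exact geom_sum_mul _ _
  have h2 : ‖∑ n ∈ Finset.range L, expc (n * x)‖ * ‖expc x - 1‖ ≤ 2 := by
    rw [← norm_mul, h1]
    refine (norm_sub_le _ _).trans ?_
    rw [norm_expc, norm_one]; norm_num
  have h3 := mul_le_mul_of_nonneg_left (four_mul_abs_sub_round_le x)
    (norm_nonneg (∑ n ∈ Finset.range L, expc (n * x)))
  linarith

lemma norm_geom_sum_shift (L t : ℕ) (x : ℝ) :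
    ‖∑ n ∈ Finset.range L, expc (((n + t : ℕ) : ℝ) * x)‖ =
      ‖∑ n ∈ Finset.range L, expc (n * x)‖ := by
  have : ∀ n : ℕ, expc (((n + t : ℕ) : ℝ) * x) = expc (n * x) * expc (t * x) := by
    intro n; rw [← expc_add]; congr 1; push_cast; ring
  simp only [this, ← Finset.sum_mul, norm_mul, norm_expc, mul_one]

/-- The normalized Fejér kernel of length `M`. -/
noncomputable def fejerWeight (M : ℕ) (y : ℝ) : ℝ :=
  ‖∑ m ∈ Finset.range M, expc (m * y)‖ ^ 2 / (M : ℝ) ^ 2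

lemma fejerWeight_nonneg (M : ℕ) (y : ℝ) : 0 ≤ fejerWeight M y := by
  unfold fejerWeight; positivity

lemma fejerWeight_le {M : ℕ} {ε y : ℝ} (hM : 0 < M) (hε : 0 < ε) (hy : ε ≤ |y - round y|) :
    fejerWeight M y ≤ 1 / (4 * (M : ℝ) ^ 2 * ε ^ 2) := by
  have h := norm_geom_sum_mul_le M y
  have hM' : (0 : ℝ) < M := by exact_mod_cast hM
  unfold fejerWeight
  set D := ‖∑ m ∈ Finset.range M, expc (m * y)‖
  have hD : 0 ≤ D := norm_nonneg _
  have h1 : D * ε ≤ 1 / 2 := (mul_le_mul_of_nonneg_left hy hD).trans h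
  have h2 : D ^ 2 * ε ^ 2 ≤ 1 / 4 := by
    have : 0 ≤ D * ε := by positivity
    nlinarith
  rw [div_le_div_iff₀ (by positivity) (by positivity)]
  nlinarith [sq_nonneg (M : ℝ), mul_le_mul_of_nonneg_left h2 (sq_nonneg (M : ℝ))]

lemma fejerWeight_expand (M : ℕ) (y : ℝ) :
    (fejerWeight M y : ℂ) = ∑ m ∈ Finset.range M, ∑ m' ∈ Finset.range M,
      expc (((m : ℝ) - m') * y) / (M : ℂ) ^ 2 := by
  unfold fejerWeight
  push_cast
  rw [← Complex.mul_conj', map_sum, Finset.sum_mul_sum, Finset.sum_div]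
  refine Finset.sum_congr rfl fun m _ => ?_
  rw [Finset.sum_div]
  refine Finset.sum_congr rfl fun m' _ => ?_
  rw [conj_expc, ← expc_add]; congr 2; ring

lemma sum_expc_div {M : ℕ} (d : ℤ) (hd : d ≠ 0) (hdM : |d| < M) :
    ∑ r ∈ Finset.range M, expc (r * (d / M : ℝ)) = 0 := by
  have hM : (0 : ℝ) < M := by
    have : (0 : ℤ) < M := (abs_nonneg d).trans_lt hdM
    exact_mod_cast this
  have h1 : (∑ r ∈ Finset.range M, expc (r * (d / M : ℝ))) * (expc (d / M : ℝ) - 1) =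
      expc (M * (d / M : ℝ)) - 1 := by
    simp only [expc_nat_mul]; exact geom_sum_mul _ _
  rw [mul_div_cancel₀ _ hM.ne', expc_int, sub_self] at h1
  refine (mul_eq_zero.mp h1).resolve_right (sub_ne_zero.mpr (expc_ne_one ?_))
  intro m hm
  rw [div_eq_iff hM.ne'] at hm
  have hm' : d = m * M := by exact_mod_cast hm
  rcases eq_or_ne m 0 with rfl | h0
  · simp at hm'; exact hd hm'
  · have : 1 ≤ |m| := Int.one_le_abs h0
    rw [hm', abs_mul, Nat.abs_cast] at hdM
    nlinarith [(Nat.cast_nonneg M : (0 : ℤ) ≤ M)]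

lemma sum_fejerWeight {M : ℕ} (hM : 0 < M) (x : ℝ) :
    ∑ r ∈ Finset.range M, fejerWeight M (x - r / M) = 1 := by
  have hM' : (M : ℂ) ≠ 0 := by exact_mod_cast hM.ne'
  have key : ∀ m ∈ Finset.range M, ∀ m' ∈ Finset.range M,
      ∑ r ∈ Finset.range M, expc (((m : ℝ) - m') * (x - r / M)) / (M : ℂ) ^ 2 =
        if m = m' then 1 / (M : ℂ) else 0 := by
    intro m hm m' hm'
    split_ifs with h
    · subst h
      simp only [sub_self, zero_mul, expc_zero, Finset.sum_const, Finset.card_range, nsmul_eq_mul]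
      field_simp
    · rw [← Finset.sum_div]
      have e : ∀ r : ℕ, expc (((m : ℝ) - m') * (x - r / M)) =
          expc (((m : ℝ) - m') * x) * expc (r * (((m' - m : ℤ) : ℝ) / M)) := by
        intro r; rw [← expc_add]; congr 1; push_cast; ring
      simp only [e]
      rw [← Finset.mul_sum, sum_expc_div, mul_zero, zero_div]
      · omega
      · rw [Finset.mem_range] at hm hm'
        rw [abs_lt]; omega
  have : ((∑ r ∈ Finset.range M, fejerWeight M (x - r / M) : ℝ) : ℂ) = 1 := by
    push_cast
    simp only [fejerWeight_expand]
    rw [Finset.sum_comm]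
    rw [Finset.sum_congr rfl fun m hm => Finset.sum_comm.trans (Finset.sum_congr rfl (key m hm))]
    rw [Finset.sum_congr rfl fun m hm => (Finset.sum_ite_eq (Finset.range M) m
      fun _ => 1 / (M : ℂ)).trans (if_pos hm)]
    simp [hM']
  exact_mod_cast this

/-- Discretized Fejér mean of a function on the circle. -/
noncomputable def fejerMean (M : ℕ) (G : ℝ → ℂ) (x : ℝ) : ℂ :=
  ∑ r ∈ Finset.range M, G (r / M) * fejerWeight M (x - r / M)

lemma norm_sub_fejerMean_le_sum {M : ℕ} (hM : 0 < M) (G : ℝ → ℂ) (x : ℝ) :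
    ‖G x - fejerMean M G x‖ ≤
      ∑ r ∈ Finset.range M, ‖G x - G (r / M)‖ * fejerWeight M (x - r / M) := by
  have h : G x - fejerMean M G x =
      ∑ r ∈ Finset.range M, (G x - G (r / M)) * fejerWeight M (x - r / M) := by
    simp only [sub_mul, Finset.sum_sub_distrib, fejerMean, ← Finset.mul_sum]
    rw [← Complex.ofReal_sum, sum_fejerWeight hM]; simp
  rw [h]
  refine (norm_sum_le _ _).trans (Finset.sum_le_sum fun r _ => ?_)
  rw [norm_mul, Complex.norm_real, Real.norm_of_nonneg (fejerWeight_nonneg _ _)]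

lemma norm_sub_fejerMean_le_two {M : ℕ} (hM : 0 < M) {G : ℝ → ℂ} (hG : ∀ x, ‖G x‖ ≤ 1) (x : ℝ) :
    ‖G x - fejerMean M G x‖ ≤ 2 := by
  refine (norm_sub_fejerMean_le_sum hM G x).trans ?_
  calc _ ≤ ∑ r ∈ Finset.range M, 2 * fejerWeight M (x - r / M) := by
        refine Finset.sum_le_sum fun r _ =>
          mul_le_mul_of_nonneg_right ?_ (fejerWeight_nonneg _ _)
        refine (norm_sub_le _ _).trans ?_
        linarith [hG x, hG (r / M)]
    _ = 2 := by rw [← Finset.mul_sum, sum_fejerWeight hM, mul_one]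

lemma norm_sub_fejerMean_le {M : ℕ} (hM : 0 < M) {G : ℝ → ℂ} (hG : ∀ x, ‖G x‖ ≤ 1)
    (hper : ∀ (x : ℝ) (m : ℤ), G (x + m) = G x) {ε κ x : ℝ} (hε : 0 < ε) (hκ : 0 ≤ κ)
    (hx : ∀ y, |x - y| ≤ ε → ‖G x - G y‖ ≤ κ) :
    ‖G x - fejerMean M G x‖ ≤ κ + 1 / (2 * M * ε ^ 2) := by
  have hM' : (0 : ℝ) < M := by exact_mod_cast hM
  refine (norm_sub_fejerMean_le_sum hM G x).trans ?_
  calc _ ≤ ∑ r ∈ Finset.range M,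
          (κ * fejerWeight M (x - r / M) + 2 * (1 / (4 * (M : ℝ) ^ 2 * ε ^ 2))) := by
        refine Finset.sum_le_sum fun r _ => ?_
        have hw := fejerWeight_nonneg M (x - r / M)
        rcases le_total |x - r / M - round (x - r / M)| ε with h | h
        · have h1 := hx (r / M + round (x - r / M)) (by rwa [← sub_sub])
          rw [hper] at h1
          have : 0 ≤ 2 * (1 / (4 * (M : ℝ) ^ 2 * ε ^ 2)) := by positivity
          nlinarith
        · have h1 := fejerWeight_le hM hε h
          have h2 : ‖G x - G (r / M)‖ ≤ 2 := by
            refine (norm_sub_le _ _).trans ?_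
            linarith [hG x, hG (r / M)]
          nlinarith [norm_nonneg (G x - G (r / M))]
    _ = κ + 1 / (2 * M * ε ^ 2) := by
        rw [Finset.sum_add_distrib, ← Finset.mul_sum, sum_fejerWeight hM]
        simp only [Finset.sum_const, Finset.card_range, nsmul_eq_mul]
        field_simp
        ring

lemma norm_sum_fejerMean_mul_expc_le {M : ℕ} (hM : 0 < M) {G : ℝ → ℂ} (hG : ∀ x, ‖G x‖ ≤ 1)
    (α θ : ℝ) (L t : ℕ) {B : ℝ}
    (hB : ∀ m < M, ∀ m' < M,
      ‖∑ n ∈ Finset.range L, expc (n * (θ + ((m : ℝ) - m') * α))‖ ≤ B) :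
    ‖∑ n ∈ Finset.range L, fejerMean M G ((n + t : ℕ) * α) * expc ((n + t : ℕ) * θ)‖ ≤ M * B := by
  have hM' : (0 : ℝ) < M := by exact_mod_cast hM
  have e : ∑ n ∈ Finset.range L, fejerMean M G ((n + t : ℕ) * α) * expc ((n + t : ℕ) * θ) =
      ∑ r ∈ Finset.range M, ∑ m ∈ Finset.range M, ∑ m' ∈ Finset.range M,
        (G (r / M) * expc (-(((m : ℝ) - m') * (r / M))) / (M : ℂ) ^ 2) *
          ∑ n ∈ Finset.range L, expc ((n + t : ℕ) * (θ + ((m : ℝ) - m') * α)) := by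
    simp only [fejerMean, fejerWeight_expand, Finset.mul_sum, Finset.sum_mul]
    rw [Finset.sum_comm]
    refine Finset.sum_congr rfl fun r _ => ?_
    rw [Finset.sum_comm]
    refine Finset.sum_congr rfl fun m _ => ?_
    rw [Finset.sum_comm]
    refine Finset.sum_congr rfl fun m' _ => Finset.sum_congr rfl fun n _ => ?_
    have e1 : expc (((m : ℝ) - m') * (((n + t : ℕ) : ℝ) * α - r / M)) * expc ((n + t : ℕ) * θ) =
        expc (-(((m : ℝ) - m') * (r / M))) * expc ((n + t : ℕ) * (θ + ((m : ℝ) - m') * α)) := by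
      rw [← expc_add, ← expc_add]; congr 1; ring
    linear_combination (G (r / M) / (M : ℂ) ^ 2) * e1
  rw [e]
  calc _ ≤ ∑ r ∈ Finset.range M, ∑ m ∈ Finset.range M, ∑ m' ∈ Finset.range M,
        (1 / (M : ℝ) ^ 2 * B) := by
        refine norm_sum_le_of_le _ fun r _ => norm_sum_le_of_le _ fun m hm =>
          norm_sum_le_of_le _ fun m' hm' => ?_
        rw [norm_mul, norm_geom_sum_shift, norm_div, norm_mul, norm_expc, mul_one, norm_pow,
          Complex.norm_natCast]
        refine mul_le_mul ?_ (hB m (Finset.mem_range.mp hm) m' (Finset.mem_range.mp hm'))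
          (norm_nonneg _) (by positivity)
        exact div_le_div_of_nonneg_right (hG _) (by positivity)
    _ = M * B := by
        simp only [Finset.sum_const, Finset.card_range, nsmul_eq_mul]
        field_simp

lemma norm_sum_shift_sub_le {u : ℕ → ℂ} (hu : ∀ n, ‖u n‖ ≤ 1) (L s : ℕ) :
    ‖∑ n ∈ Finset.range L, u n - ∑ n ∈ Finset.range L, u (n + s)‖ ≤ 2 * s := by
  have h1 := Finset.sum_range_add u L s
  have h2 := Finset.sum_range_add u s L
  rw [add_comm s L, h1] at h2
  simp only [add_comm s] at h2
  have e : ∑ n ∈ Finset.range L, u n - ∑ n ∈ Finset.range L, u (n + s) =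
      ∑ n ∈ Finset.range s, u n - ∑ n ∈ Finset.range s, u (L + n) := by
    linear_combination h2
  have b : ∀ f : ℕ → ℕ, ‖∑ n ∈ Finset.range s, u (f n)‖ ≤ s := fun f => by
    refine (norm_sum_le_of_le _ fun n _ => hu (f n)).trans ?_
    simp
  rw [e]
  refine (norm_sub_le _ _).trans ?_
  have h3 := b id
  have h4 := b (L + ·)
  simp only [id] at h3
  linarith

/-- Van der Corput's inequality, in inverse form: a large sum has a large correlation
with one of its shifts by a multiple of `h₀`. -/
lemma exists_large_correlation {u : ℕ → ℂ} (hu : ∀ n, ‖u n‖ ≤ 1) {L H h₀ : ℕ} {δ : ℝ}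
    (hδ : 0 < δ) (hL : 0 < L) (hH : 8 / δ ^ 2 ≤ H) (hLH : 4 * (H * h₀) ≤ δ * L)
    (hS : δ * L ≤ ‖∑ n ∈ Finset.range L, u n‖) :
    ∃ i j : ℕ, j < i ∧ i < H ∧ δ ^ 2 * L / 8 ≤
      ‖∑ n ∈ Finset.range L, u (n + i * h₀) * (starRingEnd ℂ) (u (n + j * h₀))‖ := by
  by_contra! hcon
  have hL' : (0 : ℝ) < L := by exact_mod_cast hL
  have hH0 : (0 : ℝ) < H := lt_of_lt_of_le (by positivity) hH
  have hH1 : 8 ≤ δ ^ 2 * H := by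
    rw [div_le_iff₀ (by positivity)] at hH; linarith
  set C : ℕ → ℕ → ℂ := fun i j =>
    ∑ n ∈ Finset.range L, u (n + i * h₀) * (starRingEnd ℂ) (u (n + j * h₀)) with hC
  have hconj : ∀ i j, ‖C i j‖ = ‖C j i‖ := by
    intro i j
    rw [← Complex.norm_conj (C i j)]
    congr 1
    simp only [hC, map_sum, map_mul, Complex.conj_conj]
    exact Finset.sum_congr rfl fun n _ => mul_comm _ _
  have hdiag : ∀ i, ‖C i i‖ ≤ L := by
    intro i
    refine (norm_sum_le_of_le (f := fun n => u (n + i * h₀) * (starRingEnd ℂ) (u (n + i * h₀)))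
      (n := fun _ => (1 : ℝ)) _ fun n _ => ?_).trans (by simp)
    rw [norm_mul, Complex.norm_conj]
    exact mul_le_one₀ (hu _) (norm_nonneg _) (hu _)
  set T := ∑ n ∈ Finset.range L, ∑ i ∈ Finset.range H, u (n + i * h₀) with hT
  set S := ∑ n ∈ Finset.range L, u n with hSdef
  have h1 : ‖H * S - T‖ ≤ H * (2 * (H * h₀)) := by
    have e : H * S - T = ∑ i ∈ Finset.range H, (S - ∑ n ∈ Finset.range L, u (n + i * h₀)) := by
      rw [Finset.sum_sub_distrib, hT, Finset.sum_comm]; simp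
    rw [e]
    refine (norm_sum_le_of_le (n := fun _ => (2 * (H * h₀) : ℝ)) _ fun i hi => ?_).trans (by simp)
    refine (norm_sum_shift_sub_le hu L (i * h₀)).trans ?_
    have : (i : ℝ) ≤ H := by exact_mod_cast (Finset.mem_range.mp hi).le
    push_cast
    gcongr
  have h2 : δ * L * H / 2 ≤ ‖T‖ := by
    have h3 : ‖(H : ℂ) * S‖ = H * ‖S‖ := by rw [norm_mul, Complex.norm_natCast]
    have h4 := norm_sub_norm_le ((H : ℂ) * S) T
    nlinarith
  have h5 : ‖T‖ ^ 2 ≤ L * ∑ n ∈ Finset.range L, ‖∑ i ∈ Finset.range H, u (n + i * h₀)‖ ^ 2 := by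
    have a1 : ‖T‖ ≤ ∑ n ∈ Finset.range L, ‖∑ i ∈ Finset.range H, u (n + i * h₀)‖ :=
      norm_sum_le _ _
    have a2 := sq_sum_le_card_mul_sum_sq (s := Finset.range L)
      (f := fun n => ‖∑ i ∈ Finset.range H, u (n + i * h₀)‖)
    rw [Finset.card_range] at a2
    exact (pow_le_pow_left₀ (norm_nonneg _) a1 2).trans a2
  have h6 : ∑ n ∈ Finset.range L, ‖∑ i ∈ Finset.range H, u (n + i * h₀)‖ ^ 2 ≤
      ∑ i ∈ Finset.range H, ∑ j ∈ Finset.range H, ‖C i j‖ := by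
    have e : ((∑ n ∈ Finset.range L, ‖∑ i ∈ Finset.range H, u (n + i * h₀)‖ ^ 2 : ℝ) : ℂ) =
        ∑ i ∈ Finset.range H, ∑ j ∈ Finset.range H, C i j := by
      push_cast
      simp only [← Complex.mul_conj', map_sum, Finset.sum_mul_sum, hC]
      rw [Finset.sum_comm]
      exact Finset.sum_congr rfl fun i _ => Finset.sum_comm
    calc _ ≤ ‖((∑ n ∈ Finset.range L, ‖∑ i ∈ Finset.range H, u (n + i * h₀)‖ ^ 2 : ℝ) : ℂ)‖ := by
          rw [Complex.norm_real]; exact le_abs_self _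
      _ ≤ _ := by
          rw [e]
          exact norm_sum_le_of_le _ fun i _ => norm_sum_le _ _
  have h7 : ∑ i ∈ Finset.range H, ∑ j ∈ Finset.range H, ‖C i j‖ <
      ∑ i ∈ Finset.range H, ∑ j ∈ Finset.range H,
        (δ ^ 2 * L / 8 + if i = j then (L : ℝ) else 0) := by
    have hp : 0 < δ ^ 2 * L / 8 := by positivity
    have hne : (Finset.range H).Nonempty := by
      rw [Finset.nonempty_range_iff]; rintro rfl; simp at hH0
    refine Finset.sum_lt_sum_of_nonempty hne fun i hi =>
      Finset.sum_lt_sum_of_nonempty hne fun j hj => ?_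
    rw [Finset.mem_range] at hi hj
    rcases lt_trichotomy i j with h | h | h
    · rw [if_neg h.ne, hconj]; linarith [hcon j i h hj]
    · subst h; rw [if_pos rfl]; linarith [hdiag i]
    · rw [if_neg h.ne']; linarith [hcon i j h hi]
  have h8 : ∑ i ∈ Finset.range H, ∑ j ∈ Finset.range H,
        (δ ^ 2 * L / 8 + if i = j then (L : ℝ) else 0) = H * (H * (δ ^ 2 * L / 8)) + H * L := by
    simp only [Finset.sum_add_distrib, Finset.sum_const, Finset.card_range, nsmul_eq_mul]
    congr 1
    rw [Finset.sum_congr rfl fun i hi => (Finset.sum_ite_eq (Finset.range H) i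
      fun _ => (L : ℝ)).trans (if_pos hi)]
    simp
  rw [h8] at h7
  have h9 : (δ * L * H / 2) ^ 2 < L * (H * (H * (δ ^ 2 * L / 8)) + H * L) := by
    calc _ ≤ ‖T‖ ^ 2 := pow_le_pow_left₀ (by positivity) h2 2
      _ ≤ _ := h5
      _ ≤ L * (∑ i ∈ Finset.range H, ∑ j ∈ Finset.range H, ‖C i j‖) := by gcongr
      _ < _ := by gcongr
  have h10 : L ^ 2 * H * (δ ^ 2 * H) < 8 * (L ^ 2 * H : ℝ) := by nlinarith
  have h11 : (0 : ℝ) < L ^ 2 * H := by positivity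
  nlinarith

/-- A set of naturals with gaps at least `P` has at most `L / P + 1` elements below `L`. -/
lemma card_filter_le_of_separated {L P : ℕ} (hP : 0 < P) (p : ℕ → Prop) [DecidablePred p]
    (hsep : ∀ n n', n < n' → p n → p n' → P ≤ n' - n) :
    ((Finset.range L).filter p).card ≤ L / P + 1 := by
  rw [← Finset.card_range (L / P + 1)]
  refine Finset.card_le_card_of_injOn (· / P) ?_ ?_
  · intro n hn
    simp only [Finset.coe_filter, Finset.mem_range, Set.mem_ofPred_eq] at hn
    simp only [Finset.coe_range, Set.mem_Iio]
    exact Nat.lt_succ_of_le (Nat.div_le_div_right hn.1.le)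
  · have key : ∀ n n', p n → p n' → n / P = n' / P → ¬ n < n' := by
      intro n n' h h' he hlt
      have h1 := hsep n n' hlt h h'
      have h2 := Nat.div_add_mod n P
      have h3 := Nat.div_add_mod n' P
      have h4 := Nat.mod_lt n hP
      have h5 := Nat.mod_lt n' hP
      rw [he] at h2
      omega
    intro n hn n' hn' he
    simp only [Finset.coe_filter, Set.mem_ofPred_eq] at hn hn'
    exact le_antisymm (not_lt.mp (key n' n hn'.2 hn.2 he.symm)) (not_lt.mp (key n n' hn.2 hn'.2 he))

/-- Multiples of a badly approximable number are rarely close to integers. -/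
lemma card_near_int_le {α c : ℝ}
    (hdio : ∀ n : ℕ, 0 < n → ∀ m : ℤ, c / n ≤ |n * α - m|) {P : ℕ} (hP : 0 < P) (hc : 0 < c)
    (L t : ℕ) :
    ((Finset.range L).filter fun n : ℕ =>
      |((n + t : ℕ) : ℝ) * α - round (((n + t : ℕ) : ℝ) * α)| ≤ c / (2 * P)).card ≤ L / P + 1 := by
  refine card_filter_le_of_separated hP _ fun n n' hlt h h' => ?_
  have hP' : (0 : ℝ) < P := by exact_mod_cast hP
  have hd := hdio (n' - n) (by omega)
    (round (((n' + t : ℕ) : ℝ) * α) - round (((n + t : ℕ) : ℝ) * α))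
  have hpos : (0 : ℝ) < ((n' - n : ℕ) : ℝ) := by exact_mod_cast Nat.sub_pos_of_lt hlt
  have hcast : ((n' - n : ℕ) : ℝ) = (n' : ℝ) - n := by push_cast [hlt.le]; ring
  have h3 : |((n' - n : ℕ) : ℝ) * α -
      ((round (((n' + t : ℕ) : ℝ) * α) - round (((n + t : ℕ) : ℝ) * α) : ℤ) : ℝ)| ≤
      c / (2 * P) + c / (2 * P) := by
    refine le_trans (le_of_eq ?_) ((abs_sub _ _).trans (add_le_add h' h))
    congr 1; rw [hcast]; push_cast; ring
  have h4 : c / (2 * P) + c / (2 * P) = c / P := by field_simp; ring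
  rw [h4] at h3
  have h5 := hd.trans h3
  rw [div_le_div_iff_of_pos_left hc hpos hP'] at h5
  exact_mod_cast h5

lemma floor_eq_floor_of_abs_sub_le {x y ε : ℝ} (hx : ε < |x - round x|) (hxy : |x - y| ≤ ε) :
    ⌊y⌋ = ⌊x⌋ := by
  have h1 := round_le x ⌊x⌋
  have h2 := round_le x (⌊x⌋ + 1)
  have h3 := Int.floor_le x
  have h4 := Int.lt_floor_add_one x
  rw [abs_of_nonneg (sub_nonneg.mpr h3)] at h1
  push_cast at h2
  rw [abs_of_neg (sub_neg.mpr h4)] at h2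
  have h5 := abs_le.mp hxy
  rw [Int.floor_eq_iff]
  constructor <;> linarith

/-- The periodic factor of the differenced phase `n⌊nα⌋`: the phase `e(-η{x})` on the set where
translation by `β` increases the integer part by `A`. -/
noncomputable def floorStepPhase (β η : ℝ) (A : ℤ) (x : ℝ) : ℂ :=
  if ⌊x + β⌋ - ⌊x⌋ = A then expc (-(η * Int.fract x)) else 0

lemma norm_floorStepPhase_le (β η : ℝ) (A : ℤ) (x : ℝ) : ‖floorStepPhase β η A x‖ ≤ 1 := by
  unfold floorStepPhase
  split_ifs
  · rw [norm_expc]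
  · simp

lemma floorStepPhase_add_int (β η : ℝ) (A : ℤ) (x : ℝ) (m : ℤ) :
    floorStepPhase β η A (x + m) = floorStepPhase β η A x := by
  unfold floorStepPhase
  rw [add_right_comm x (m : ℝ) β, Int.floor_add_intCast, Int.floor_add_intCast,
    Int.fract_add_intCast, add_sub_add_right_eq_sub]

lemma norm_floorStepPhase_sub_le {β η x y ε : ℝ} (A : ℤ) (hη : |η| ≤ 1 / 2)
    (h1 : ε < |x - round x|) (h2 : ε < |x + β - round (x + β)|) (hxy : |x - y| ≤ ε) :
    ‖floorStepPhase β η A x - floorStepPhase β η A y‖ ≤ 4 * ε := by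
  have e1 := floor_eq_floor_of_abs_sub_le h1 hxy
  have e2 : ⌊y + β⌋ = ⌊x + β⌋ :=
    floor_eq_floor_of_abs_sub_le h2 (by rwa [add_sub_add_right_eq_sub])
  have hε : 0 ≤ ε := (abs_nonneg _).trans hxy
  unfold floorStepPhase
  rw [e1, e2]
  split_ifs
  · refine (norm_expc_sub_expc_le _ _).trans ?_
    have e3 : -(η * Int.fract x) - -(η * Int.fract y) = -(η * (x - y)) := by
      unfold Int.fract; rw [e1]; ring
    rw [e3, abs_neg, abs_mul]
    have h3 : |η| * |x - y| ≤ 1 / 2 * ε := mul_le_mul hη hxy (abs_nonneg _) (by norm_num)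
    nlinarith [Real.pi_pos, Real.pi_le_four]
  · simp; exact hε

lemma exists_linear_resonance {α c : ℝ} (hc : 0 < c) (hc1 : c ≤ 1)
    (hdio : ∀ n : ℕ, 0 < n → ∀ m : ℤ, c / n ≤ |n * α - m|)
    {η θ γ : ℝ} (hη : |η| ≤ 1 / 2) (hγ : 0 < γ) (A : ℤ) (s t : ℕ) {L P M : ℕ}
    (hP : 40 / γ ≤ P) (hPL : P ≤ L) (hM : 16 * (P : ℝ) ^ 2 / (c ^ 2 * γ) ≤ M)
    (hS : γ * L ≤ ‖∑ n ∈ Finset.range L,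
      floorStepPhase (s * α) η A ((n + t : ℕ) * α) * expc ((n + t : ℕ) * θ)‖) :
    ∃ j m : ℤ, |j| ≤ M ∧ |θ + j * α - m| ≤ M / (γ * L) := by
  have hP0 : (0 : ℝ) < P := lt_of_lt_of_le (by positivity) hP
  have hP0' : 0 < P := by exact_mod_cast hP0
  have hM0 : (0 : ℝ) < M := lt_of_lt_of_le (by positivity) hM
  have hM0' : 0 < M := by exact_mod_cast hM0
  have hPL' : (P : ℝ) ≤ L := by exact_mod_cast hPL
  have hL0 : (0 : ℝ) < L := hP0.trans_le hPL'
  set G := floorStepPhase (s * α) η A with hG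
  have hGn : ∀ x, ‖G x‖ ≤ 1 := norm_floorStepPhase_le _ _ _
  set ε : ℝ := c / (2 * P) with hε
  have hε0 : 0 < ε := by positivity
  set p : ℕ → ℕ → Prop := fun t n =>
    |((n + t : ℕ) : ℝ) * α - round (((n + t : ℕ) : ℝ) * α)| ≤ ε with hp
  have hcard : ∀ t, (((Finset.range L).filter (p t)).card : ℝ) ≤ 2 * (L / P) := by
    intro t
    have h1 : (((Finset.range L).filter (p t)).card : ℝ) ≤ (L / P : ℕ) + 1 := by
      have := Nat.cast_le (α := ℝ).mpr (card_near_int_le hdio hP0' hc L t)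
      rwa [Nat.cast_add, Nat.cast_one] at this
    have h2 : ((L / P : ℕ) : ℝ) ≤ L / P := Nat.cast_div_le
    have h3 : 1 ≤ (L : ℝ) / P := by rwa [le_div_iff₀ hP0, one_mul]
    linarith
  have hpt : ∀ n ∈ Finset.range L, ‖G ((n + t : ℕ) * α) - fejerMean M G ((n + t : ℕ) * α)‖ ≤
      (4 * ε + 1 / (2 * M * ε ^ 2)) + 2 * (if p t n then 1 else 0) +
        2 * (if p (t + s) n then 1 else 0) := by
    intro n _
    have hpos : 0 ≤ 4 * ε + 1 / (2 * M * ε ^ 2) := by positivity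
    have h2 := norm_sub_fejerMean_le_two hM0' hGn ((n + t : ℕ) * α)
    by_cases h : p t n
    · rw [if_pos h]; split_ifs <;> linarith
    by_cases h' : p (t + s) n
    · rw [if_pos h', if_neg h]; linarith
    rw [if_neg h, if_neg h']
    simp only [hp, not_le] at h h'
    have e : ((n + (t + s) : ℕ) : ℝ) * α = ((n + t : ℕ) : ℝ) * α + s * α := by push_cast; ring
    rw [e] at h'
    have := norm_sub_fejerMean_le hM0' hGn (floorStepPhase_add_int _ _ _) hε0
      (by positivity : (0 : ℝ) ≤ 4 * ε)
      (fun y hy => norm_floorStepPhase_sub_le A hη h h' hy)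
    linarith
  have herr : ∑ n ∈ Finset.range L, ‖G ((n + t : ℕ) * α) - fejerMean M G ((n + t : ℕ) * α)‖ ≤
      3 / 8 * (γ * L) := by
    refine (Finset.sum_le_sum hpt).trans ?_
    rw [Finset.sum_add_distrib, Finset.sum_add_distrib, ← Finset.mul_sum, ← Finset.mul_sum,
      Finset.sum_boole, Finset.sum_boole]
    simp only [Finset.sum_const, Finset.card_range, nsmul_eq_mul]
    have h1 := hcard t
    have h2 := hcard (t + s)
    have h3 : 4 * ε ≤ 2 / P := by
      rw [hε, le_div_iff₀ hP0]; field_simp; linarith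
    have h4 : 10 / P ≤ γ / 4 := by
      rw [div_le_iff₀ hγ] at hP
      rw [div_le_iff₀ hP0]; linarith
    have h5 : 1 / (2 * M * ε ^ 2) ≤ γ / 8 := by
      have : 1 / (2 * M * ε ^ 2) = 2 * P ^ 2 / (c ^ 2 * M) := by rw [hε]; field_simp
      rw [this, div_le_div_iff₀ (by positivity) (by norm_num)]
      rw [div_le_iff₀ (by positivity)] at hM
      linarith
    have h6 : (L : ℝ) * (4 * ε + 1 / (2 * M * ε ^ 2)) ≤ L * (2 / P + γ / 8) := by gcongr
    have h7 : (L : ℝ) * (10 / P) ≤ L * (γ / 4) := by gcongr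
    have h8 : (L : ℝ) * (10 / P) = L * (2 / P) + 8 * (L / P) := by ring
    linarith
  have hdiff : ‖∑ n ∈ Finset.range L, G ((n + t : ℕ) * α) * expc ((n + t : ℕ) * θ)‖ ≤
      ‖∑ n ∈ Finset.range L, fejerMean M G ((n + t : ℕ) * α) * expc ((n + t : ℕ) * θ)‖ +
        3 / 8 * (γ * L) := by
    have e : ∑ n ∈ Finset.range L, G ((n + t : ℕ) * α) * expc ((n + t : ℕ) * θ) =
        ∑ n ∈ Finset.range L, fejerMean M G ((n + t : ℕ) * α) * expc ((n + t : ℕ) * θ) +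
        ∑ n ∈ Finset.range L,
          (G ((n + t : ℕ) * α) - fejerMean M G ((n + t : ℕ) * α)) * expc ((n + t : ℕ) * θ) := by
      rw [← Finset.sum_add_distrib]
      exact Finset.sum_congr rfl fun n _ => by ring
    rw [e]
    refine (norm_add_le _ _).trans (add_le_add_right ?_ _)
    refine le_trans (norm_sum_le_of_le _ fun n _ => ?_) herr
    rw [norm_mul, norm_expc, mul_one]
  obtain ⟨a, ha, b, hb, hab⟩ : ∃ a < M, ∃ b < M, γ * L / (2 * M) ≤
      ‖∑ n ∈ Finset.range L, expc (n * (θ + ((a : ℝ) - b) * α))‖ := by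
    by_contra! hcon
    have h1 := norm_sum_fejerMean_mul_expc_le hM0' hGn α θ L t
      (fun a ha b hb => (hcon a ha b hb).le)
    have h2 : (M : ℝ) * (γ * L / (2 * M)) = γ * L / 2 := by field_simp
    have h3 : 0 < γ * L := by positivity
    linarith
  refine ⟨(a : ℤ) - b, round (θ + ((a : ℝ) - b) * α), by rw [abs_le]; omega, ?_⟩
  have h1 := norm_geom_sum_mul_le L (θ + ((a : ℝ) - b) * α)
  have h2 := (mul_le_mul_of_nonneg_right hab (abs_nonneg _)).trans h1
  push_cast
  rw [le_div_iff₀ (by positivity)]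
  rw [div_mul_eq_mul_div, div_le_iff₀ (by positivity)] at h2
  linarith

lemma floor_step_cases (x β : ℝ) :
    ⌊x + β⌋ - ⌊x⌋ = ⌊β⌋ ∨ ⌊x + β⌋ - ⌊x⌋ = ⌊β⌋ + 1 := by
  have h1 := Int.le_floor_add x β
  have h2 := Int.le_floor_add_floor x β
  omega

lemma correlation_eq {α ξ : ℝ} (n s : ℕ) :
    expc (ξ * (((n + s : ℕ) : ℝ) * (⌊((n + s : ℕ) : ℝ) * α⌋ : ℝ))) *
        (starRingEnd ℂ) (expc (ξ * ((n : ℝ) * (⌊(n : ℝ) * α⌋ : ℝ)))) =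
      ∑ i ∈ Finset.range 2, expc (ξ * s * (⌊s * α⌋ + i : ℤ)) *
        (floorStepPhase (s * α) (ξ * s - round (ξ * s)) (⌊s * α⌋ + i) (n * α) *
          expc (n * (ξ * (⌊s * α⌋ + i : ℤ) + (ξ * s - round (ξ * s)) * α))) := by
  have key : ∀ A : ℤ, ⌊(n : ℝ) * α + s * α⌋ - ⌊(n : ℝ) * α⌋ = A →
      expc (ξ * (((n + s : ℕ) : ℝ) * (⌊((n + s : ℕ) : ℝ) * α⌋ : ℝ))) *
        (starRingEnd ℂ) (expc (ξ * ((n : ℝ) * (⌊(n : ℝ) * α⌋ : ℝ)))) =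
      expc (ξ * s * A) * (expc (-((ξ * s - round (ξ * s)) * Int.fract (n * α))) *
          expc (n * (ξ * A + (ξ * s - round (ξ * s)) * α))) := by
    intro A hA
    have e0 : ((n + s : ℕ) : ℝ) * α = n * α + s * α := by push_cast; ring
    have e1 : (⌊((n + s : ℕ) : ℝ) * α⌋ : ℝ) = A + ⌊(n : ℝ) * α⌋ := by
      rw [e0, ← hA]; push_cast; ring
    rw [conj_expc, ← expc_add, ← expc_add, ← expc_add, e1,
      ← expc_add_int _ (-(round (ξ * s) * ⌊(n : ℝ) * α⌋))]
    congr 1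
    unfold Int.fract
    push_cast
    ring
  rw [Finset.sum_range_succ, Finset.sum_range_one]
  unfold floorStepPhase
  rcases floor_step_cases (n * α) (s * α) with h | h
  · rw [if_pos (by simpa using h), if_neg (by rw [h]; simp), key _ h]
    simp
  · rw [if_neg (by rw [h]; simp), if_pos (by simpa using h), key _ h]
    simp

lemma exists_quadratic_resonance {α c : ℝ} (hc : 0 < c) (hc1 : c ≤ 1)
    (hdio : ∀ n : ℕ, 0 < n → ∀ m : ℤ, c / n ≤ |n * α - m|)
    {δ ξ : ℝ} (hδ : 0 < δ) {L H h₀ P M : ℕ}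
    (hH : 8 / δ ^ 2 ≤ H) (hLH : 4 * (H * h₀) ≤ δ * L)
    (hP : 640 / δ ^ 2 ≤ P) (hPL : P ≤ L) (hM : 256 * (P : ℝ) ^ 2 / (c ^ 2 * δ ^ 2) ≤ M)
    (hS : δ * L ≤ ‖∑ n ∈ Finset.Icc 1 L, expc (ξ * ((n : ℝ) * (⌊(n : ℝ) * α⌋ : ℝ)))‖) :
    ∃ (s : ℕ) (A j m : ℤ), h₀ ≤ s ∧ s ≤ H * h₀ ∧ ⌊s * α⌋ ≤ A ∧ A ≤ ⌊s * α⌋ + 1 ∧ |j| ≤ M ∧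
      |ξ * A + (ξ * s - round (ξ * s)) * α + j * α - m| ≤ 16 * M / (δ ^ 2 * L) := by
  have hP0 : (0 : ℝ) < P := lt_of_lt_of_le (by positivity) hP
  have hL0 : 0 < L := lt_of_lt_of_le (by exact_mod_cast hP0) hPL
  set u : ℕ → ℂ := fun n => expc (ξ * ((n : ℝ) * (⌊(n : ℝ) * α⌋ : ℝ))) with hu
  have hS' : δ * L ≤ ‖∑ n ∈ Finset.range L, u (n + 1)‖ := by
    rwa [Finset.range_eq_Ico, Finset.sum_Ico_add' u, zero_add, Finset.Ico_add_one_right_eq_Icc]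
  obtain ⟨a, b, hba, haH, hab⟩ := exists_large_correlation (u := fun n => u (n + 1))
    (fun n => (norm_expc _).le) hδ hL0 hH hLH hS'
  set s := (a - b) * h₀ with hs
  set t := b * h₀ + 1 with ht
  have hidx : ∀ n : ℕ, n + a * h₀ + 1 = n + t + s := by
    intro n
    have : a * h₀ = b * h₀ + (a - b) * h₀ := by rw [← Nat.add_mul]; congr 1; omega
    omega
  have hcorr : ∑ n ∈ Finset.range L, u (n + a * h₀ + 1) * (starRingEnd ℂ) (u (n + b * h₀ + 1)) =
      ∑ i ∈ Finset.range 2, expc (ξ * s * (⌊s * α⌋ + i : ℤ)) * ∑ n ∈ Finset.range L,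
        (floorStepPhase (s * α) (ξ * s - round (ξ * s)) (⌊s * α⌋ + i) ((n + t : ℕ) * α) *
          expc ((n + t : ℕ) * (ξ * (⌊s * α⌋ + i : ℤ) + (ξ * s - round (ξ * s)) * α))) := by
    simp only [Finset.mul_sum]
    rw [Finset.sum_comm]
    refine Finset.sum_congr rfl fun n _ => ?_
    rw [hidx n, ← correlation_eq]
    rfl
  rw [hcorr] at hab
  obtain ⟨i, hi, hbig⟩ : ∃ i ∈ Finset.range 2, δ ^ 2 / 16 * L ≤ ‖∑ n ∈ Finset.range L,
        (floorStepPhase (s * α) (ξ * s - round (ξ * s)) (⌊s * α⌋ + i) ((n + t : ℕ) * α) *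
          expc ((n + t : ℕ) * (ξ * (⌊s * α⌋ + i : ℤ) + (ξ * s - round (ξ * s)) * α)))‖ := by
    by_contra! hcon
    have h1 := hab.trans (norm_sum_le _ _)
    simp only [norm_mul, norm_expc, one_mul] at h1
    have h2 := Finset.sum_lt_sum_of_nonempty (by simp) hcon
    simp only [Finset.sum_const, Finset.card_range, nsmul_eq_mul] at h2
    push_cast at h1 h2
    linarith
  obtain ⟨j, m, hj, hjm⟩ := exists_linear_resonance (γ := δ ^ 2 / 16) hc hc1 hdio
    (abs_sub_round (ξ * s)) (by positivity) (⌊s * α⌋ + i) s t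
    (by convert hP using 1; field_simp; norm_num) hPL
    (by convert hM using 1; field_simp; norm_num) hbig
  refine ⟨s, ⌊s * α⌋ + i, j, m, ?_, ?_, by omega, ?_, hj, hjm.trans (le_of_eq ?_)⟩
  · exact Nat.le_mul_of_pos_left _ (by omega)
  · exact Nat.mul_le_mul_right _ (by omega)
  · rw [Finset.mem_range] at hi; omega
  · field_simp

lemma sq_num_den {α : ℝ} {r v : ℕ} (hv : 0 < v) (hα : α ^ 2 = r / v) : (v : ℝ) * α ^ 2 = r := by
  rw [hα]; field_simp

lemma irrational_nat_mul_ne {α : ℝ} (hirr : Irrational α) {s : ℕ} (hs : 0 < s) (m : ℤ) :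
    (s : ℝ) * α ≠ m :=
  (hirr.natCast_mul hs.ne').ne_int m

lemma one_le_abs_norm_form {α : ℝ} (hirr : Irrational α) {r v : ℕ} (hv : 0 < v)
    (hα : α ^ 2 = r / v) {s : ℕ} (hs : 0 < s) (m : ℤ) :
    1 ≤ |(v : ℤ) * m ^ 2 - r * s ^ 2| := by
  refine Int.one_le_abs fun h => ?_
  have h1 : (v : ℝ) * m ^ 2 - r * s ^ 2 = 0 := by exact_mod_cast h
  rw [← sq_num_den hv hα] at h1
  have hv' : (v : ℝ) ≠ 0 := by exact_mod_cast hv.ne'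
  have h2 : (v : ℝ) * ((s * α - m) * (s * α - (-m : ℤ))) = 0 := by push_cast; linear_combination -h1
  rcases mul_eq_zero.mp ((mul_eq_zero.mp h2).resolve_left hv') with h | h
  · exact irrational_nat_mul_ne hirr hs _ (sub_eq_zero.mp h)
  · exact irrational_nat_mul_ne hirr hs _ (sub_eq_zero.mp h)

/-- Square roots of rationals are badly approximable. -/
lemma div_le_abs_mul_sub {α : ℝ} (hα0 : 0 < α) (hirr : Irrational α) {r v : ℕ} (hv : 0 < v)
    (hα : α ^ 2 = r / v) (n : ℕ) (hn : 0 < n) (m : ℤ) :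
    1 / (v * (2 * α + 1)) / n ≤ |n * α - m| := by
  have hv1 : (1 : ℝ) ≤ v := by exact_mod_cast hv
  have hn1 : (1 : ℝ) ≤ n := by exact_mod_cast hn
  rw [div_div, div_le_iff₀ (by positivity)]
  rcases le_total 1 |n * α - m| with h | h
  · have : 1 ≤ (v : ℝ) * (2 * α + 1) * n := by
      have h1 : 1 ≤ 2 * α + 1 := by linarith
      exact one_le_mul_of_one_le_of_one_le (one_le_mul_of_one_le_of_one_le hv1 h1) hn1
    exact one_le_mul_of_one_le_of_one_le h this
  · have h1 : (1 : ℝ) ≤ |(v : ℝ) * m ^ 2 - r * n ^ 2| := by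
      exact_mod_cast one_le_abs_norm_form hirr hv hα hn m
    have e : (v : ℝ) * m ^ 2 - r * n ^ 2 = (n * α - m) * (v * -(n * α + m)) := by
      rw [← sq_num_den hv hα]; ring
    rw [e, abs_mul, abs_mul, abs_neg, Nat.abs_cast] at h1
    have h2 : |n * α + m| ≤ (2 * α + 1) * n := by
      rw [abs_le] at h ⊢
      have : 0 < n * α := by positivity
      constructor <;> nlinarith
    calc 1 ≤ |n * α - m| * (v * |n * α + m|) := h1
      _ ≤ |n * α - m| * (v * ((2 * α + 1) * n)) := by gcongr
      _ = _ := by ring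

lemma approximation_of_resonance {α : ℝ} (hα0 : 0 < α) (hirr : Irrational α) {r v : ℕ}
    (hv : 0 < v) (hα : α ^ 2 = r / v) {ξ E : ℝ} (hξ : |ξ| ≤ 1 / 2) (hE : E ≤ 1)
    {s M : ℕ} {A j m : ℤ} (hs : 0 < s) (hA1 : ⌊s * α⌋ ≤ A) (hA2 : A ≤ ⌊s * α⌋ + 1)
    (hj : |j| ≤ M)
    (h : |ξ * A + (ξ * s - round (ξ * s)) * α + j * α - m| ≤ E) :
    ∃ (q : ℕ) (a b : ℤ), 0 < q ∧ (q : ℝ) ≤ (v * (α + 1) ^ 2 + r) * s ^ 2 ∧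
      |(b : ℝ)| ≤ v * (4 * α + 3) * ((M + s) * s) ∧
      |ξ - (a + b * α) / q| ≤ E / (s * α) := by
  have hs' : (1 : ℝ) ≤ s := by exact_mod_cast hs
  have hv' : (0 : ℝ) < v := by exact_mod_cast hv
  have hsα : 0 < s * α := by positivity
  have hA0 : (0 : ℝ) ≤ A := by
    have : 0 ≤ ⌊s * α⌋ := Int.floor_nonneg.mpr hsα.le
    exact_mod_cast this.trans hA1
  have hA3 : (A : ℝ) ≤ s * α + 1 := by
    have h1 : (A : ℝ) ≤ ⌊s * α⌋ + 1 := by exact_mod_cast hA2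
    linarith [Int.floor_le (s * α)]
  have hA4 : (A : ℝ) ≤ (α + 1) * s := by linarith
  obtain ⟨J, hJdef⟩ : ∃ J : ℤ, J = j - round (ξ * s) := ⟨_, rfl⟩
  have hJ : |(J : ℝ)| ≤ M + s := by
    have h1 := abs_sub_round (ξ * s)
    have h2 : |ξ * s| ≤ 1 / 2 * s := by
      rw [abs_mul, Nat.abs_cast]; gcongr
    have h3 : |(j : ℝ)| ≤ M := by exact_mod_cast hj
    rw [hJdef]
    push_cast
    rw [abs_le] at *
    constructor <;> linarith
  set W : ℝ := A + s * α with hW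
  have hW0 : 0 < W := by linarith
  have h' : |ξ * W + J * α - m| ≤ E := by
    convert h using 2; rw [hJdef, hW]; push_cast; ring
  have hm : |(m : ℝ)| ≤ (3 * α + 2) * (M + s) := by
    have h1 : |ξ * W| ≤ 1 / 2 * W := by
      rw [abs_mul, abs_of_pos hW0]; gcongr
    have h2 : |J * α| ≤ (M + s) * α := by
      rw [abs_mul, abs_of_pos hα0]; gcongr
    have hM0 : (0 : ℝ) ≤ M := Nat.cast_nonneg M
    have hMα : 0 ≤ M * α := by positivity
    rw [abs_le] at *
    constructor <;> nlinarith
  obtain ⟨D, hD⟩ : ∃ D : ℤ, D = v * A ^ 2 - r * s ^ 2 := ⟨_, rfl⟩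
  have hD1 : 1 ≤ |D| := hD ▸ one_le_abs_norm_form hirr hv hα hs A
  have hD0 : (D : ℝ) ≠ 0 := by
    have : D ≠ 0 := by rintro rfl; simp at hD1
    exact_mod_cast this
  have hDR : (D : ℝ) = v * A ^ 2 - r * s ^ 2 := by exact_mod_cast congrArg (Int.cast (R := ℝ)) hD
  have hDW : (D : ℝ) = v * (A - s * α) * W := by
    rw [hDR, ← sq_num_den hv hα, hW]; ring
  obtain ⟨σ, hσ, hσD⟩ : ∃ σ : ℤ, |σ| = 1 ∧ (D.natAbs : ℤ) = σ * D := by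
    rcases le_total 0 D with h | h
    · exact ⟨1, by simp, by omega⟩
    · exact ⟨-1, by simp, by omega⟩
  have hσR : |(σ : ℝ)| = 1 := by exact_mod_cast hσ
  have hσ0 : (σ : ℝ) ≠ 0 := by rintro h0; rw [h0] at hσR; simp at hσR
  have hσDR : (D.natAbs : ℝ) = σ * D := by
    have := congrArg (Int.cast (R := ℝ)) hσD
    rwa [Int.cast_mul, Int.cast_natCast] at this
  refine ⟨D.natAbs, σ * (v * m * A + J * s * r), σ * -(v * J * A + v * m * s), ?_, ?_, ?_, ?_⟩
  · exact Int.natAbs_pos.mpr (by exact_mod_cast hD0)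
  · rw [Nat.cast_natAbs, Int.cast_abs, hDR]
    refine (abs_sub _ _).trans ?_
    rw [abs_of_nonneg (by positivity), abs_of_nonneg (by positivity)]
    have : (A : ℝ) ^ 2 ≤ ((α + 1) * s) ^ 2 := pow_le_pow_left₀ hA0 hA4 2
    nlinarith
  · push_cast
    rw [abs_mul, hσR, one_mul, abs_neg]
    refine (abs_add_le _ _).trans ?_
    simp only [abs_mul, Nat.abs_cast, abs_of_nonneg hA0]
    calc v * |(J : ℝ)| * A + v * |(m : ℝ)| * s
        ≤ v * (M + s) * ((α + 1) * s) + v * ((3 * α + 2) * (M + s)) * s := by gcongr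
      _ = _ := by ring
  · have hnum : ((σ * (v * m * A + J * s * r) : ℤ) : ℝ) +
        ((σ * -(v * J * A + v * m * s) : ℤ) : ℝ) * α =
        σ * (v * (A - s * α) * (m - J * α)) := by
      push_cast; rw [← sq_num_den hv hα]; ring
    have hvA : (v : ℝ) * (A - s * α) ≠ 0 := by
      intro h0; rw [hDW, h0, zero_mul] at hD0; exact hD0 rfl
    have heq : ξ - (((σ * (v * m * A + J * s * r) : ℤ) : ℝ) +
        ((σ * -(v * J * A + v * m * s) : ℤ) : ℝ) * α) / (D.natAbs : ℕ) =
        (ξ * W + J * α - m) / W := by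
      rw [hnum, hσDR, hDW, mul_div_mul_left _ _ hσ0, mul_div_mul_left _ _ hvA]
      field_simp
      ring
    rw [heq, abs_div, abs_of_pos hW0]
    have hE0 : 0 ≤ E := (abs_nonneg _).trans h'
    exact div_le_div₀ hE0 h' hsα (by linarith)

/-- **Inverse theorem for the exponential sum** (Lemma: minor arcs, quantitative form).
Let `k` be a positive rational with `√k` irrational.  Then there exist absolute constants
`C₁, C₂ > 0` and a constant `C₃ = C₃(k) > 0` such that for every `N ≥ 1`, `δ ∈ (0, 1/2)` and
`ξ ∈ [−1/2, 1/2)` with `|(1/N) ∑_{n=1}^{⌊N⌋} e(ξ n⌊n√k⌋)| > δ`, either `N ≤ C₃ δ^{−2C₁}`, or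
there exist `q ∈ ℕ` and `a, b ∈ ℤ` with `q ≤ C₃ δ^{−C₁}`, `|b| ≤ C₃ δ^{−C₁}` and
`|ξ − (a + b√k)/q| < C₂ δ^{−C₁} N^{−1}`. -/
theorem exponential_sum_inverse_theorem :
    ∃ C₁ > (0 : ℝ), ∃ C₂ > (0 : ℝ), ∀ (k : ℚ), 0 < k → Irrational (Real.sqrt (k : ℝ)) →
      ∃ C₃ > (0 : ℝ), ∀ (N δ ξ : ℝ), 1 ≤ N → δ ∈ Set.Ioo (0 : ℝ) (1 / 2) →
        ξ ∈ Set.Ico (-(1 / 2) : ℝ) (1 / 2) →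
        δ < ‖expSum (k : ℝ) N ξ‖ →
        (N ≤ C₃ * δ ^ (-(2 * C₁)) ∨
          ∃ (q : ℕ) (a b : ℤ), 0 < q ∧ (q : ℝ) ≤ C₃ * δ ^ (-C₁) ∧
            |(b : ℝ)| ≤ C₃ * δ ^ (-C₁) ∧
            |ξ - ((a : ℝ) + (b : ℝ) * Real.sqrt (k : ℝ)) / q| < C₂ * δ ^ (-C₁) / N) := by

  refine ⟨8, by norm_num, 2, by norm_num, fun k hk hirr => ?_⟩
  set α : ℝ := Real.sqrt (k : ℝ) with hαdef
  have hkR : (0 : ℝ) < k := by exact_mod_cast hk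
  have hα0 : 0 < α := Real.sqrt_pos.mpr hkR
  obtain ⟨r, hr⟩ : ∃ r : ℕ, (r : ℤ) = k.num :=
    ⟨k.num.toNat, Int.toNat_of_nonneg (Rat.num_pos.mpr hk).le⟩
  set v : ℕ := k.den with hvdef
  have hv : 0 < v := k.den_pos
  have hv1 : (1 : ℝ) ≤ v := by exact_mod_cast hv
  have hα2 : α ^ 2 = r / v := by
    rw [hαdef, Real.sq_sqrt hkR.le, Rat.cast_def k, ← hr, Int.cast_natCast]
  obtain ⟨c, hcdef⟩ : ∃ c : ℝ, c = 1 / (v * (2 * α + 1)) := ⟨_, rfl⟩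
  have hc : 0 < c := by rw [hcdef]; positivity
  have hc1 : c ≤ 1 := by
    rw [hcdef, div_le_one (by positivity)]
    exact one_le_mul_of_one_le_of_one_le hv1 (by linarith)
  have hdio : ∀ n : ℕ, 0 < n → ∀ m : ℤ, c / n ≤ |n * α - m| := by
    rw [hcdef]; exact div_le_abs_mul_sub hα0 hirr hv hα2
  obtain ⟨K, hK⟩ : ∃ K : ℝ, K = 256 * 641 ^ 2 / c ^ 2 + 1 := ⟨_, rfl⟩
  have hK0 : 0 < K := by rw [hK]; positivity
  obtain ⟨h₀, hh₀⟩ : ∃ h₀ : ℕ, 32 * K / α ≤ h₀ := exists_nat_ge _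
  have hh₀' : (0 : ℝ) < h₀ := lt_of_lt_of_le (by positivity) hh₀
  rw [div_le_iff₀ hα0] at hh₀
  obtain ⟨X, hX⟩ : ∃ X : ℝ, X = 2 * (16 * K + 641 + 36 * h₀) := ⟨_, rfl⟩
  obtain ⟨Y, hY⟩ : ∃ Y : ℝ, Y = (v * (α + 1) ^ 2 + r) * (9 * h₀) ^ 2 := ⟨_, rfl⟩
  obtain ⟨Z, hZ⟩ : ∃ Z : ℝ, Z = v * (4 * α + 3) * ((K + 9 * h₀) * (9 * h₀)) := ⟨_, rfl⟩
  have hX0 : 0 < X := by rw [hX]; positivity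
  have hY0 : 0 ≤ Y := by rw [hY]; positivity
  have hZ0 : 0 ≤ Z := by rw [hZ]; positivity
  refine ⟨X + Y + Z, by positivity, fun N δ ξ hN hδ hξ hS => ?_⟩
  obtain ⟨hδ0, hδ1⟩ := hδ
  obtain ⟨d, hd⟩ : ∃ d : ℝ, d = δ⁻¹ := ⟨_, rfl⟩
  have hd1 : 1 ≤ d := by rw [hd]; exact (one_le_inv₀ hδ0).mpr (by linarith)
  have hd0 : 0 < d := by linarith
  have hδd : δ = d⁻¹ := by rw [hd, inv_inv]
  have e8 : δ ^ (-8 : ℝ) = d ^ 8 := by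
    rw [Real.rpow_neg hδ0.le, hd, inv_pow]; norm_cast
  have e16 : δ ^ (-(2 * 8) : ℝ) = d ^ 16 := by
    rw [Real.rpow_neg hδ0.le, hd, inv_pow]; norm_num
  rw [e8, e16, or_iff_not_imp_left, not_le]
  intro hNbig
  have hN0 : 0 < N := by linarith
  set L : ℕ := (⌊N⌋).toNat with hLdef
  have hLfl : (L : ℝ) = ⌊N⌋ := by
    have : 0 ≤ ⌊N⌋ := Int.floor_nonneg.mpr hN0.le
    exact_mod_cast Int.toNat_of_nonneg this
  have hLN : (L : ℝ) ≤ N := hLfl ▸ Int.floor_le N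
  have hNL : N ≤ 2 * L := by
    have h1 : (1 : ℤ) ≤ ⌊N⌋ := Int.le_floor.mpr (by exact_mod_cast hN)
    have h2 : (1 : ℝ) ≤ L := by rw [hLfl]; exact_mod_cast h1
    have h3 := Int.lt_floor_add_one N
    rw [← hLfl] at h3; linarith
  have hpow : ∀ i ≤ 16, d ^ i ≤ d ^ 16 := fun i hi => pow_le_pow_right₀ hd1 hi
  have hLbig : (16 * K + 641 + 36 * h₀) * d ^ 16 ≤ L := by
    have : X * d ^ 16 ≤ (X + Y + Z) * d ^ 16 := by gcongr; linarith
    have h2 : 2 * (16 * K + 641 + 36 * h₀) * d ^ 16 = X * d ^ 16 := by rw [hX]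
    linarith
  have hL0 : (0 : ℝ) < L := by linarith
  have hsum : δ * L ≤ ‖∑ n ∈ Finset.Icc 1 L, expc (ξ * ((n : ℝ) * (⌊(n : ℝ) * α⌋ : ℝ)))‖ := by
    unfold expSum at hS
    rw [norm_mul, norm_inv, Complex.norm_real, Real.norm_of_nonneg hN0.le, ← div_eq_inv_mul,
      lt_div_iff₀ hN0] at hS
    exact (mul_le_mul_of_nonneg_left hLN hδ0.le).trans hS.le
  have hd2 : 1 ≤ d ^ 2 := one_le_pow₀ hd1
  have hd6 : 1 ≤ d ^ 6 := one_le_pow₀ hd1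
  obtain ⟨H, hH1, hH2⟩ : ∃ H : ℕ, 8 * d ^ 2 ≤ H ∧ (H : ℝ) ≤ 9 * d ^ 2 :=
    ⟨⌈8 * d ^ 2⌉₊, Nat.le_ceil _, by
      linarith [Nat.ceil_lt_add_one (a := 8 * d ^ 2) (by positivity)]⟩
  obtain ⟨P, hP1, hP2⟩ : ∃ P : ℕ, 640 * d ^ 2 ≤ P ∧ (P : ℝ) ≤ 641 * d ^ 2 :=
    ⟨⌈640 * d ^ 2⌉₊, Nat.le_ceil _, by
      linarith [Nat.ceil_lt_add_one (a := 640 * d ^ 2) (by positivity)]⟩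
  obtain ⟨M, hM1, hM2⟩ : ∃ M : ℕ, 256 * (P : ℝ) ^ 2 / (c ^ 2 * δ ^ 2) ≤ M ∧
      (M : ℝ) ≤ K * d ^ 6 := by
    refine ⟨⌈256 * (P : ℝ) ^ 2 / (c ^ 2 * δ ^ 2)⌉₊, Nat.le_ceil _, ?_⟩
    have h1 := Nat.ceil_lt_add_one (a := 256 * (P : ℝ) ^ 2 / (c ^ 2 * δ ^ 2)) (by positivity)
    have h2 : 256 * (P : ℝ) ^ 2 / (c ^ 2 * δ ^ 2) ≤
        256 * (641 * d ^ 2) ^ 2 / (c ^ 2 * δ ^ 2) := by gcongr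
    have h3 : 256 * (641 * d ^ 2) ^ 2 / (c ^ 2 * δ ^ 2) = 256 * 641 ^ 2 / c ^ 2 * d ^ 6 := by
      rw [hδd]; field_simp
    rw [h3] at h2
    rw [hK]
    linarith
  have hdiv : ∀ x : ℝ, x / δ ^ 2 = x * d ^ 2 := fun x => by rw [hδd]; field_simp
  obtain ⟨s, A, j, m, hs1, hs2, hA1, hA2, hj, hres⟩ := exists_quadratic_resonance (h₀ := h₀)
    hc hc1 hdio hδ0 (by rwa [hdiv]) (H := H) (L := L) (P := P) (M := M) (ξ := ξ)
    (by
      rw [hδd, ← div_eq_inv_mul, le_div_iff₀ hd0]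
      have h1 : 4 * (H * h₀) * d ≤ 4 * (9 * d ^ 2 * h₀) * d := by gcongr
      have h2 : 36 * h₀ * d ^ 3 ≤ 36 * h₀ * d ^ 16 := by gcongr; norm_num
      have h3 : 0 ≤ (16 * K + 641) * d ^ 16 := by positivity
      linarith)
    (by rwa [hdiv])
    (by
      have h2 := hpow 2 (by norm_num)
      have h3 : 0 ≤ (16 * K + 36 * h₀) * d ^ 16 := by positivity
      have : (P : ℝ) ≤ L := by linarith [pow_pos hd0 16]
      exact_mod_cast this)
    hM1 hsum
  set E : ℝ := 16 * M / (δ ^ 2 * L) with hEdef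
  have hE : E ≤ 16 * K * d ^ 8 / L := by
    have h1 : E = 16 * M * d ^ 2 / L := by rw [hEdef, hδd]; field_simp
    rw [h1]
    refine div_le_div_of_nonneg_right ?_ hL0.le
    calc 16 * M * d ^ 2 ≤ 16 * (K * d ^ 6) * d ^ 2 := by gcongr
      _ = 16 * K * d ^ 8 := by ring
  have hE1 : E ≤ 1 := by
    refine hE.trans ?_
    rw [div_le_one hL0]
    have h2 : 16 * K * d ^ 8 ≤ 16 * K * d ^ 16 := by gcongr; norm_num
    have h3 : 0 ≤ (641 + 36 * h₀) * d ^ 16 := by positivity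
    linarith
  have hs0 : 0 < s := lt_of_lt_of_le (by exact_mod_cast hh₀') hs1
  have hs3 : (s : ℝ) ≤ 9 * h₀ * d ^ 2 := by
    have h1 : (s : ℝ) ≤ H * h₀ := by exact_mod_cast hs2
    have h2 : (H : ℝ) * h₀ ≤ 9 * d ^ 2 * h₀ := by gcongr
    linarith
  have hξ' : |ξ| ≤ 1 / 2 := abs_le.mpr ⟨hξ.1, hξ.2.le⟩
  obtain ⟨q, a, b, hq0, hq, hb, hab⟩ :=
    approximation_of_resonance hα0 hirr hv hα2 hξ' hE1 hs0 hA1 hA2 hj hres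
  refine ⟨q, a, b, hq0, hq.trans ?_, hb.trans ?_, hab.trans_lt ?_⟩
  · calc (v * (α + 1) ^ 2 + r) * (s : ℝ) ^ 2
        ≤ (v * (α + 1) ^ 2 + r) * (9 * h₀ * d ^ 2) ^ 2 := by gcongr
      _ = Y * d ^ 4 := by rw [hY]; ring
      _ ≤ Y * d ^ 8 := by gcongr; norm_num
      _ ≤ (X + Y + Z) * d ^ 8 := by gcongr; linarith
  · calc v * (4 * α + 3) * ((M + s) * (s : ℝ))
        ≤ v * (4 * α + 3) * ((K * d ^ 6 + 9 * h₀ * d ^ 6) * (9 * h₀ * d ^ 2)) := by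
          gcongr
          refine hs3.trans ?_
          gcongr
          norm_num
      _ = Z * d ^ 8 := by rw [hZ]; ring
      _ ≤ (X + Y + Z) * d ^ 8 := by gcongr; linarith
  · have h1 : 32 * K ≤ s * α := hh₀.trans (by gcongr)
    have hd8 : 0 < d ^ 8 := by positivity
    have hsα : 0 < s * α := by positivity
    calc E / (s * α) ≤ (16 * K * d ^ 8 / L) / (s * α) := by gcongr
      _ ≤ (16 * K * d ^ 8 / (N / 2)) / (32 * K) := by gcongr; linarith
      _ = d ^ 8 / N := by field_simp; norm_num
      _ < 2 * d ^ 8 / N := by gcongr; linarith
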